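/- Let Z be a real Banach space, let 0 < η < 1, and let t₀ < T be real. Let f : ℝ → Z be continuous on (t₀, T] and Bochner integrable on [t₀, T], and define g(t) = (1/Γ(1−η)) ∫_{t₀}^{t} (t−u)^{−η} f(u) du for t ∈ (t₀, T]. Assume g extends to a continuous function on [t₀, T] with g(t₀⁺) = c, that g is differentiable on (t₀, T) with derivative g′ continuous on (t₀, T), and that for the given t ∈ (t₀, T] the function s ↦ (t−s)^{η−1} g′(s) is Bochner integrable on (t₀, t). Then (1/Γ(η)) ∫_{t₀}^{t} (t−s)^{η−1} g′(s) ds = f(t) − (c/Γ(η)) (t−t₀)^{η−1}; that is, _{t₀}I_t^η (_{t₀}D_t^η f)(t) = f(t) − ((_{t₀}I_t^{1−η} f)(t₀⁺)/Γ(η)) (t−t₀)^{η−1}. -/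

import Mathlib

open MeasureTheory intervalIntegral

theorem integral_rpow_mul_rpow {a b v s : ℝ} (ha : 0 < a) (hb : 0 < b) (hvs : v < s) :
    ∫ u in v..s, (s - u) ^ (a - 1) * (u - v) ^ (b - 1) =
      ProbabilityTheory.beta b a * (s - v) ^ (a + b - 1) := by
  have hd : 0 < s - v := sub_pos.2 hvs
  have key := Complex.betaIntegral_scaled (b : ℂ) (a : ℂ) hd
  rw [Complex.betaIntegral_eq_Gamma_mul_div _ _ (by simpa) (by simpa)] at key
  have hcongr : ∫ x in (0 : ℝ)..(s - v),
      (x : ℂ) ^ ((b : ℂ) - 1) * (((s - v : ℝ) : ℂ) - x) ^ ((a : ℂ) - 1) =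
      ∫ x in (0 : ℝ)..(s - v), ((x ^ (b - 1) * (s - v - x) ^ (a - 1) : ℝ) : ℂ) := by
    refine intervalIntegral.integral_congr fun x hx => ?_
    rw [Set.uIcc_of_le hd.le] at hx
    have hx' : 0 ≤ s - v - x := by linarith [hx.2]
    rw [Complex.ofReal_mul, Complex.ofReal_cpow hx.1, Complex.ofReal_cpow hx']
    push_cast
    rfl
  rw [hcongr, intervalIntegral.integral_ofReal, ← Complex.ofReal_add, Complex.Gamma_ofReal,
    Complex.Gamma_ofReal, Complex.Gamma_ofReal, ← Complex.ofReal_one, ← Complex.ofReal_sub,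
    ← Complex.ofReal_cpow hd.le] at key
  norm_cast at key
  have shift := intervalIntegral.integral_comp_sub_right
    (fun x : ℝ => x ^ (b - 1) * (s - v - x) ^ (a - 1)) (a := v) (b := s) v
  rw [sub_self, key] at shift
  rw [ProbabilityTheory.beta, add_comm a b, mul_comm, ← shift]
  refine intervalIntegral.integral_congr fun u _ => ?_
  rw [mul_comm, sub_sub_sub_cancel_right]

theorem integral_rpow_smul_integral_rpow_smul {Z : Type*} [NormedAddCommGroup Z]
    [NormedSpace ℝ Z] [CompleteSpace Z] {a b t₀ s : ℝ} (ha : 0 < a) (hb : 0 < b) (hab : 1 ≤ a + b)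
    (hs : t₀ ≤ s) {f : ℝ → Z} (hf : IntervalIntegrable f volume t₀ s) :
    ∫ u in t₀..s, (s - u) ^ (a - 1) • ∫ v in t₀..u, (u - v) ^ (b - 1) • f v =
      ProbabilityTheory.beta b a • ∫ v in t₀..s, (s - v) ^ (a + b - 1) • f v := by
  let k : ℝ → ℝ → ℝ := fun u v => if v < u then (s - u) ^ (a - 1) * (u - v) ^ (b - 1) else 0
  set μ := (volume : Measure ℝ).restrict (Set.Ioc t₀ s) with hμ
  have hfμ : Integrable f μ := (intervalIntegrable_iff_integrableOn_Ioc_of_le hs).1 hf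
  have hind : ∀ v, (fun u => k u v) =
      (Set.Ioi v).indicator fun u => (s - u) ^ (a - 1) * (u - v) ^ (b - 1) := by
    intro v; ext u; simp [k, Set.indicator_apply]
  have hinter : ∀ v ∈ Set.Ioc t₀ s, Set.Ioi v ∩ Set.Ioc t₀ s = Set.Ioc v s := by
    intro v hv; ext x
    exact ⟨fun h => ⟨h.1, h.2.2⟩, fun h => ⟨h.1, hv.1.trans h.1, h.2⟩⟩
  have hk_int : ∀ v ∈ Set.Ioc t₀ s, v < s →
      ∫ u, k u v ∂μ = ProbabilityTheory.beta b a * (s - v) ^ (a + b - 1) := by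
    intro v hv hvs
    rw [hind, MeasureTheory.integral_indicator measurableSet_Ioi, hμ, Measure.restrict_restrict measurableSet_Ioi,
      hinter v hv, ← intervalIntegral.integral_of_le hvs.le, integral_rpow_mul_rpow ha hb hvs]
  have hk_nonneg : ∀ v, ∀ u ∈ Set.Ioc t₀ s, 0 ≤ k u v := by
    intro v u hu
    dsimp only [k]
    split_ifs with h
    · exact mul_nonneg (Real.rpow_nonneg (by linarith [hu.2]) _) (Real.rpow_nonneg (by linarith) _)
    · rfl
  have hlt : ∀ᵐ v ∂μ, v ∈ Set.Ioc t₀ s ∧ v < s := by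
    filter_upwards [ae_restrict_mem measurableSet_Ioc,
      ae_restrict_of_ae (Measure.ae_ne volume s)] with v hv hne
    exact ⟨hv, lt_of_le_of_ne hv.2 hne⟩
  have hk_meas : Measurable (Function.uncurry k) := by
    refine Measurable.ite (measurableSet_lt measurable_snd measurable_fst) ?_ measurable_const
    fun_prop
  have hF : Integrable (Function.uncurry fun u v => k u v • f v) (μ.prod μ) := by
    rw [integrable_prod_iff']
    · constructor
      · filter_upwards [hlt] with v hv
        refine Integrable.smul_const (f := fun u => k u v) ?_ (f v)
        refine Integrable.of_integral_ne_zero ?_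
        rw [hk_int v hv.1 hv.2]
        exact (mul_pos (ProbabilityTheory.beta_pos hb ha)
          (Real.rpow_pos_of_pos (sub_pos.2 hv.2) _)).ne'
      · have hbd : Integrable
            (fun v => (ProbabilityTheory.beta b a * (s - v) ^ (a + b - 1)) * ‖f v‖) μ := by
          refine (hfμ.norm.bdd_mul
            (c := ProbabilityTheory.beta b a * (s - t₀) ^ (a + b - 1)) ?_ ?_)
          · exact Measurable.aestronglyMeasurable (by fun_prop)
          · filter_upwards [hlt] with v hv
            have hB := ProbabilityTheory.beta_pos hb ha
            rw [Real.norm_of_nonneg (mul_nonneg hB.le (Real.rpow_nonneg (by linarith [hv.2]) _))]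
            exact mul_le_mul_of_nonneg_left (Real.rpow_le_rpow (by linarith [hv.2])
              (by linarith [hv.1.1]) (by linarith)) hB.le
        refine hbd.congr ?_
        filter_upwards [hlt] with v hv
        rw [← hk_int v hv.1 hv.2, ← MeasureTheory.integral_mul_const]
        refine integral_congr_ae ?_
        filter_upwards [ae_restrict_mem measurableSet_Ioc] with u hu
        simp only [Function.uncurry, norm_smul, Real.norm_of_nonneg (hk_nonneg v u hu)]
    · exact hk_meas.aestronglyMeasurable.smul hfμ.aestronglyMeasurable.comp_snd
  have hswap := integral_integral_swap hF
  rw [intervalIntegral.integral_of_le hs, intervalIntegral.integral_of_le hs, ← MeasureTheory.integral_smul]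
  convert hswap using 1
  · refine integral_congr_ae ?_
    filter_upwards [ae_restrict_mem measurableSet_Ioc] with u hu
    have hset : Set.Ioc t₀ s ∩ Set.Iio u = Set.Ioo t₀ u := by
      ext x
      exact ⟨fun h => ⟨h.1.1, h.2⟩, fun h => ⟨⟨h.1, h.2.le.trans hu.2⟩, h.2⟩⟩
    have hk_smul : (fun v => k u v • f v) =
        (Set.Iio u).indicator fun v => (s - u) ^ (a - 1) • (u - v) ^ (b - 1) • f v := by
      ext v
      by_cases h : v < u <;> simp [k, h, mul_smul]
    rw [hk_smul, MeasureTheory.integral_indicator measurableSet_Iio, hμ,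
      Measure.restrict_restrict measurableSet_Iio, Set.inter_comm, hset, MeasureTheory.integral_smul,
      intervalIntegral.integral_of_le hu.1.le, integral_Ioc_eq_integral_Ioo]
  · refine integral_congr_ae ?_
    filter_upwards [hlt] with v hv
    rw [_root_.integral_smul_const, hk_int v hv.1 hv.2, mul_smul]

theorem rpow_sub_rpow_sub_le {η x ε : ℝ} (hη0 : 0 < η) (hη1 : η ≤ 1) (hx : 0 < x)
    (hε : 0 ≤ ε) : x ^ η - max (x - ε) 0 ^ η ≤ ε * x ^ (η - 1) := by
  have hsplit : x ^ η = x * x ^ (η - 1) := by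
    rw [← Real.rpow_one_add' hx.le (by linarith)]; congr 1; ring
  have hmax : (x - ε) * x ^ (η - 1) ≤ max (x - ε) 0 ^ η := by
    rcases le_or_gt (x - ε) 0 with h | h
    · rw [max_eq_right h, Real.zero_rpow hη0.ne']
      exact mul_nonpos_of_nonpos_of_nonneg h (Real.rpow_nonneg hx.le _)
    · rw [max_eq_left h.le]
      have hsplit' : (x - ε) ^ η = (x - ε) * (x - ε) ^ (η - 1) := by
        rw [← Real.rpow_one_add' h.le (by linarith)]; congr 1; ring
      rw [hsplit']
      exact mul_le_mul_of_nonneg_left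
        (Real.rpow_le_rpow_of_nonpos h (by linarith) (by linarith)) h.le
  linarith

theorem hasDerivWithinAt_integral_rpow_smul {Z : Type*} [NormedAddCommGroup Z] [NormedSpace ℝ Z]
    {η t₀ t : ℝ} (hη0 : 0 < η) (hη1 : η ≤ 1) (ht : t₀ < t) {h : ℝ → Z}
    (hh : IntervalIntegrable h volume t₀ t)
    (hint : IntervalIntegrable (fun s => (t - s) ^ (η - 1) • h s) volume t₀ t) :
    HasDerivWithinAt (fun s => ∫ v in t₀..s, (s - v) ^ η • h v)
      (η • ∫ v in t₀..t, (t - v) ^ (η - 1) • h v) (Set.Iio t) t := by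
  have hext : ∀ s ∈ Set.Ioc t₀ t,
      ∫ v in t₀..s, (s - v) ^ η • h v = ∫ v in t₀..t, max (s - v) 0 ^ η • h v := by
    intro s hs
    rw [intervalIntegral.integral_of_le hs.1.le, intervalIntegral.integral_of_le ht.le,
      setIntegral_eq_of_subset_of_forall_sdiff_eq_zero measurableSet_Ioc
        (Set.Ioc_subset_Ioc_right hs.2)]
    · refine setIntegral_congr_fun measurableSet_Ioc fun v hv => ?_
      rw [max_eq_left (sub_nonneg.2 hv.2)]
    · intro v hv
      have hvs : s < v := by
        by_contra! hle
        exact hv.2 ⟨hv.1.1, hle⟩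
      rw [max_eq_right (sub_nonpos.2 hvs.le), Real.zero_rpow hη0.ne', zero_smul]
  have hcont : ∀ s, Continuous fun v : ℝ => max (s - v) 0 ^ η := fun s =>
    ((continuous_const.sub continuous_id).max continuous_const).rpow_const fun _ => Or.inr hη0.le
  have hI : ∀ s, IntervalIntegrable (fun v => max (s - v) 0 ^ η • h v) volume t₀ t := fun s =>
    hh.continuousOn_smul (hcont s).continuousOn
  have hne : ∀ᵐ v : ℝ, v ∈ Set.uIoc t₀ t → t₀ < v ∧ v < t := by
    filter_upwards [Measure.ae_ne volume t] with v hv hmem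
    rw [Set.uIoc_of_le ht.le] at hmem
    exact ⟨hmem.1, lt_of_le_of_ne hmem.2 hv⟩
  rw [hasDerivWithinAt_iff_tendsto_slope' Set.self_notMem_Iio, ← intervalIntegral.integral_smul]
  have hev : ∀ᶠ s in nhdsWithin t (Set.Iio t), s ∈ Set.Ioo t₀ t := Ioo_mem_nhdsLT ht
  have hlim : Filter.Tendsto
      (fun s => ∫ v in t₀..t, ((s - t)⁻¹ * (max (s - v) 0 ^ η - max (t - v) 0 ^ η)) • h v)
      (nhdsWithin t (Set.Iio t)) (nhds (∫ v in t₀..t, η • (t - v) ^ (η - 1) • h v)) := by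
    refine intervalIntegral.tendsto_integral_filter_of_dominated_convergence
      (fun v => ‖(t - v) ^ (η - 1) • h v‖) ?_ ?_ hint.norm ?_
    · refine Filter.Eventually.of_forall fun s => ?_
      exact (((hcont s).sub (hcont t)).const_smul (s - t)⁻¹).aestronglyMeasurable.smul
        hh.def'.aestronglyMeasurable
    · filter_upwards [hev] with s hs
      filter_upwards [hne] with v hv hmem
      have hvt := (hv hmem).2
      have hts : 0 < t - s := sub_pos.2 hs.2
      have hx : 0 < t - v := sub_pos.2 hvt
      rw [norm_smul, norm_smul]
      refine mul_le_mul_of_nonneg_right ?_ (norm_nonneg _)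
      have hle := rpow_sub_rpow_sub_le hη0 hη1 hx hts.le
      rw [show t - v - (t - s) = s - v by ring] at hle
      have hmono : max (s - v) 0 ^ η ≤ (t - v) ^ η :=
        Real.rpow_le_rpow (le_max_right _ _) (max_le (by linarith [hs.2]) hx.le) hη0.le
      rw [max_eq_left hx.le, norm_mul, norm_inv, Real.norm_eq_abs (s - t), abs_sub_comm,
        abs_of_pos hts, Real.norm_eq_abs, abs_sub_comm, abs_of_nonneg (sub_nonneg.2 hmono),
        Real.norm_of_nonneg (Real.rpow_nonneg hx.le _), inv_mul_le_iff₀ hts]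
      exact hle
    · filter_upwards [hne] with v hv hmem
      have hx : 0 < t - v := sub_pos.2 (hv hmem).2
      rw [smul_smul]
      refine Filter.Tendsto.smul_const ?_ (h v)
      have hd : HasDerivAt (fun s : ℝ => max (s - v) 0 ^ η) (η * (t - v) ^ (η - 1)) t := by
        have h1 : HasDerivAt (fun s : ℝ => (s - v) ^ η) (η * (t - v) ^ (η - 1)) t := by
          simpa using ((hasDerivAt_id t).sub_const v).rpow_const (p := η) (Or.inl hx.ne')
        refine h1.congr_of_eventuallyEq ?_
        filter_upwards [lt_mem_nhds (hv hmem).2] with s hs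
        rw [max_eq_left (sub_pos.2 hs).le]
      have hs := (hasDerivWithinAt_iff_tendsto_slope' Set.self_notMem_Iio).1
        (hd.hasDerivWithinAt (s := Set.Iio t))
      exact hs
  refine hlim.congr' ?_
  filter_upwards [hev] with s hs
  rw [slope_def_module, hext s ⟨hs.1, hs.2.le⟩, hext t ⟨ht, le_rfl⟩,
    ← intervalIntegral.integral_sub (hI s) (hI t), ← intervalIntegral.integral_smul]
  simp only [mul_smul, sub_smul]

/-- `_{t₀}I_t^η (_{t₀}D_t^η f)(t) = f(t) − ((_{t₀}I_t^{1−η} f)(t₀⁺)/Γ(η)) (t−t₀)^{η−1}`: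
if `g = _{t₀}I_t^{1−η} f` is continuous up to `t₀` with right limit `c` at `t₀` and is
continuously differentiable on `(t₀, T)`, then the fractional integral of order `η` of
its derivative equals `f(t) − (c/Γ(η)) (t−t₀)^{η−1}`. -/
theorem rl_integral_rl_deriv {Z : Type*} [NormedAddCommGroup Z] [NormedSpace ℝ Z]
    [CompleteSpace Z] (η t₀ T : ℝ) (hη0 : 0 < η) (hη1 : η < 1) (htT : t₀ < T)
    (f : ℝ → Z) (hfc : ContinuousOn f (Set.Ioc t₀ T))
    (hfi : IntervalIntegrable f volume t₀ T)
    (g g' : ℝ → Z) (c : Z)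
    (hg : ∀ s ∈ Set.Ioc t₀ T,
      g s = (1 / Real.Gamma (1 - η)) • ∫ u in t₀..s, (s - u) ^ (-η) • f u)
    (hgcont : ContinuousOn g (Set.Icc t₀ T))
    (hgc : Filter.Tendsto g (nhdsWithin t₀ (Set.Ioi t₀)) (nhds c))
    (hgd : ∀ s ∈ Set.Ioo t₀ T, HasDerivAt g (g' s) s)
    (hg'c : ContinuousOn g' (Set.Ioo t₀ T))
    (t : ℝ) (ht : t ∈ Set.Ioc t₀ T)
    (hint : IntervalIntegrable (fun s => (t - s) ^ (η - 1) • g' s) volume t₀ t) :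
    (1 / Real.Gamma η) • ∫ s in t₀..t, (t - s) ^ (η - 1) • g' s =
      f t - ((t - t₀) ^ (η - 1) / Real.Gamma η) • c := by
  obtain ⟨ht0, htT'⟩ := ht
  have hΓη := Real.Gamma_pos_of_pos hη0
  have hΓη' := Real.Gamma_pos_of_pos (sub_pos.2 hη1)
  have hg0 : g t₀ = c := by
    refine tendsto_nhds_unique (f := g) ?_ hgc
    rw [← nhdsWithin_Ioc_eq_nhdsGT htT]
    exact (hgcont t₀ (Set.left_mem_Icc.2 htT.le)).mono Set.Ioc_subset_Icc_self
  have hg'i : IntervalIntegrable g' volume t₀ t := by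
    have hcont : ContinuousOn (fun s : ℝ => (t - s) ^ (1 - η)) (Set.uIcc t₀ t) :=
      ((continuous_const.sub continuous_id).rpow_const fun _ =>
        Or.inr (sub_pos.2 hη1).le).continuousOn
    refine (hint.continuousOn_smul hcont).congr_ae ?_
    rw [Set.uIoc_of_le ht0.le]
    filter_upwards [ae_restrict_mem measurableSet_Ioc,
      ae_restrict_of_ae (Measure.ae_ne volume t)] with s hs hne
    have hpos : 0 < t - s := sub_pos.2 (lt_of_le_of_ne hs.2 hne)
    rw [smul_smul, ← Real.rpow_add hpos]
    simp
  have hgint : ∀ u ∈ Set.Icc t₀ t, g u = c + ∫ v in t₀..u, g' v := by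
    intro u hu
    rw [intervalIntegral.integral_eq_sub_of_hasDerivAt_of_le hu.1
      (hgcont.mono (Set.Icc_subset_Icc_right (hu.2.trans htT')))
      (fun x hx => hgd x ⟨hx.1, hx.2.trans_le (hu.2.trans htT')⟩)
      (hg'i.mono_set (by
        rw [Set.uIcc_of_le hu.1, Set.uIcc_of_le ht0.le]; exact Set.Icc_subset_Icc_right hu.2)),
      hg0]
    abel
  have hprim : ∀ s ∈ Set.Ioc t₀ t, ∫ v in t₀..s, f v =
      (1 / (η * Real.Gamma η)) •
        ((s - t₀) ^ η • c + ∫ v in t₀..s, (s - v) ^ η • g' v) := by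
    intro s hs
    have hsub : Set.uIcc t₀ s ⊆ Set.uIcc t₀ t := by
      rw [Set.uIcc_of_le hs.1.le, Set.uIcc_of_le ht0.le]; exact Set.Icc_subset_Icc_right hs.2
    have hsubT : Set.uIcc t₀ s ⊆ Set.uIcc t₀ T := by
      rw [Set.uIcc_of_le hs.1.le, Set.uIcc_of_le htT.le]
      exact Set.Icc_subset_Icc_right (hs.2.trans htT')
    have hf1 := integral_rpow_smul_integral_rpow_smul hη0 (sub_pos.2 hη1) (by linarith)
      hs.1.le (hfi.mono_set hsubT)
    have hg1 := integral_rpow_smul_integral_rpow_smul hη0 one_pos (by linarith)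
      hs.1.le (hg'i.mono_set hsub)
    simp only [ProbabilityTheory.beta, sub_add_cancel, Real.Gamma_one, div_one, sub_self,
      add_sub_cancel, Real.rpow_zero, one_smul, one_mul, add_sub_cancel_right, sub_sub_cancel_left]
      at hf1 hg1
    have hfg : ∫ u in t₀..s, (s - u) ^ (η - 1) • ∫ v in t₀..u, (u - v) ^ (-η) • f v =
        Real.Gamma (1 - η) • ∫ u in t₀..s, (s - u) ^ (η - 1) • g u := by
      rw [← intervalIntegral.integral_smul]
      refine intervalIntegral.integral_congr_ae (Filter.Eventually.of_forall fun u hu => ?_)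
      rw [Set.uIoc_of_le hs.1.le] at hu
      rw [hg u ⟨hu.1, hu.2.trans (hs.2.trans htT')⟩, smul_comm, smul_smul (Real.Gamma (1 - η)),
        mul_one_div_cancel hΓη'.ne', one_smul]
    have hker : IntervalIntegrable (fun u : ℝ => (s - u) ^ (η - 1)) volume t₀ s := by
      have := (intervalIntegral.intervalIntegrable_rpow' (a := s - t₀) (b := 0)
        (show -1 < η - 1 by linarith)).comp_sub_left s
      simpa using this
    have hker_int : ∫ u in t₀..s, (s - u) ^ (η - 1) = (s - t₀) ^ η / η := by
      rw [intervalIntegral.integral_comp_sub_left (fun x : ℝ => x ^ (η - 1)) s, sub_self,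
        integral_rpow (Or.inl (by linarith))]
      simp [Real.zero_rpow hη0.ne']
    have hG : ContinuousOn (fun u => ∫ v in t₀..u, g' v) (Set.uIcc t₀ s) :=
      intervalIntegral.continuousOn_primitive_interval' (hg'i.mono_set hsub) Set.left_mem_uIcc
    have hsum : ∫ u in t₀..s, (s - u) ^ (η - 1) • g u =
        ((s - t₀) ^ η / η) • c + ∫ u in t₀..s, (s - u) ^ (η - 1) • ∫ v in t₀..u, g' v := by
      rw [← hker_int, ← intervalIntegral.integral_smul_const,
        ← intervalIntegral.integral_add (hker.smul_continuousOn continuousOn_const) (hker.smul_continuousOn hG)]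
      refine intervalIntegral.integral_congr fun u hu => ?_
      rw [Set.uIcc_of_le hs.1.le] at hu
      rw [hgint u ⟨hu.1, hu.2.trans hs.2⟩, smul_add]
    rw [hfg, hsum, hg1, add_comm 1 η, Real.Gamma_add_one hη0.ne', mul_smul] at hf1
    have hf2 := smul_right_injective Z hΓη'.ne' hf1.symm
    rw [← eq_inv_smul_iff₀ hΓη.ne'] at hf2
    rw [hf2, smul_add, smul_add, smul_smul, smul_smul, smul_smul]
    congr 2 <;> field_simp
  have hder_f : HasDerivWithinAt (fun s => ∫ v in t₀..s, f v) (f t) (Set.Iio t) t := by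
    have hfc' : ContinuousOn f (Set.Ioc t₀ t) := hfc.mono (Set.Ioc_subset_Ioc_right htT')
    have hfi' : IntervalIntegrable f volume t₀ t := hfi.mono_set (by
      rw [Set.uIcc_of_le ht0.le, Set.uIcc_of_le htT.le]; exact Set.Icc_subset_Icc_right htT')
    have hmem : Set.Ioc t₀ t ∈ nhdsWithin t (Set.Iic t) := Ioc_mem_nhdsLE ht0
    refine HasDerivWithinAt.mono (t := Set.Iic t) ?_ Set.Iio_subset_Iic_self
    refine intervalIntegral.integral_hasDerivWithinAt_right hfi' (t := Set.Iic t) ?_ ?_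
    · exact ⟨Set.Ioc t₀ t, hmem, hfc'.aestronglyMeasurable measurableSet_Ioc⟩
    · exact (hfc' t ⟨ht0, le_rfl⟩).mono_of_mem_nhdsWithin hmem
  have hder_pow : HasDerivWithinAt (fun s : ℝ => (s - t₀) ^ η • c)
      ((η * (t - t₀) ^ (η - 1)) • c) (Set.Iio t) t := by
    refine HasDerivAt.hasDerivWithinAt (HasDerivAt.smul_const ?_ c)
    simpa using ((hasDerivAt_id t).sub_const t₀).rpow_const (p := η) (Or.inl (sub_pos.2 ht0).ne')
  have hder := (hder_pow.add (hasDerivWithinAt_integral_rpow_smul hη0 hη1.le ht0 hg'i hint)).const_smul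
    (1 / (η * Real.Gamma η))
  have hder_f' := hder.congr_of_eventuallyEq (f₁ := fun s => ∫ v in t₀..s, f v)
    (by filter_upwards [Ioo_mem_nhdsLT ht0] with s hs using hprim s ⟨hs.1, hs.2.le⟩)
    (hprim t ⟨ht0, le_rfl⟩)
  have heq := (uniqueDiffWithinAt_Iio t).eq_deriv _ hder_f hder_f'
  rw [heq, smul_add, smul_smul, smul_smul, eq_sub_iff_add_eq, add_comm]
  congr 2 <;> field_simp
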